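/- Let d ≥ 1, C₀ > 0, C > 0, and let V : ℝ^d → ℝ be smooth with V(x) ≥ −C₀ for all x and |∂^β V(x)| ≤ C^{|β|+1} β! for all x and all multi-indices β with |β| ≥ 2. Then there exist ε > 0 and C' > 0 such that for every N ∈ ℕ and every u ∈ 𝒮(ℝ^d): Re Σ_{|α|≤N} (ε^{2|α|}/α!²)·⟨∂^α(V·u), ∂^α u⟩ ≥ −C' · Σ_{|α|≤N} (ε^{2|α|}/α!²)·‖∂^α u‖². -/

import Mathlib

open MeasureTheory Complex Filter
open scoped BigOperators RealInnerProductSpace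

noncomputable section

/-- Euclidean space `ℝ^d`. -/
abbrev Ed (d : ℕ) : Type := EuclideanSpace ℝ (Fin d)

/-- Partial derivative in the `j`-th coordinate direction. -/
def pd {F : Type*} [NormedAddCommGroup F] [NormedSpace ℝ F]
    (d : ℕ) (j : Fin d) (f : Ed d → F) : Ed d → F :=
  fun x => fderiv ℝ f x (EuclideanSpace.single j 1)

/-- Iterated partial derivative `∂^α` for a multi-index `α : Fin d → ℕ`. -/
def md {F : Type*} [NormedAddCommGroup F] [NormedSpace ℝ F]
    {d : ℕ} (α : Fin d → ℕ) (f : Ed d → F) : Ed d → F :=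
  (List.finRange d).foldr (fun j g => (pd d j)^[α j] g) f

/-- Length `|α| = α₁ + ⋯ + α_d` of a multi-index. -/
def mlen {d : ℕ} (α : Fin d → ℕ) : ℕ := ∑ j, α j

/-- `L²` inner product `⟨f, g⟩ = ∫ f(x) conj(g(x)) dx` (antilinear in the second factor). -/
def ip {d : ℕ} (f g : Ed d → ℂ) : ℂ := ∫ x, f x * (starRingEnd ℂ) (g x)

/-- Square `‖f‖²` of the `L²` norm. -/
def l2sq {d : ℕ} (f : Ed d → ℂ) : ℝ := ∫ x, ‖f x‖ ^ 2

/-- The finite set of multi-indices `α : Fin d → ℕ` with `|α| ≤ N`. -/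
def MI (d N : ℕ) : Finset (Fin d → ℕ) :=
  (Finset.Iic fun _ : Fin d => N).filter fun α => ∑ j, α j ≤ N

/-- The factorial `α! = α₁!⋯α_d!` of a multi-index. -/
def mfact {d : ℕ} (α : Fin d → ℕ) : ℕ := ∏ j, Nat.factorial (α j)

/-- The binomial coefficient `binom(α,β) = Π binom(α_j, β_j)` of two multi-indices. -/
def mchoose {d : ℕ} (α β : Fin d → ℕ) : ℕ := ∏ j, Nat.choose (α j) (β j)


section PartialDerivatives

variable {F : Type*} [NormedAddCommGroup F] [NormedSpace ℝ F] {d : ℕ}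

lemma contDiff_pd {f : Ed d → F} (hf : ContDiff ℝ (⊤ : ℕ∞) f) (j : Fin d) :
    ContDiff ℝ (⊤ : ℕ∞) (pd d j f) :=
  (hf.fderiv_right (m := (⊤ : ℕ∞)) (by simp)).clm_apply contDiff_const

lemma contDiff_iterate_pd {f : Ed d → F} (hf : ContDiff ℝ (⊤ : ℕ∞) f) (j : Fin d) (n : ℕ) :
    ContDiff ℝ (⊤ : ℕ∞) ((pd d j)^[n] f) := by
  induction n with
  | zero => exact hf
  | succ n ih => rw [Function.iterate_succ_apply']; exact contDiff_pd ih j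

lemma ContDiff.differentiable_of_top {f : Ed d → F} (hf : ContDiff ℝ (⊤ : ℕ∞) f) :
    Differentiable ℝ f := hf.differentiable (by simp)

lemma pd_ofReal_mul {V : Ed d → ℝ} {u : Ed d → ℂ} (hV : Differentiable ℝ V)
    (hu : Differentiable ℝ u) (j : Fin d) :
    pd d j (fun x => (V x : ℂ) * u x) =
      fun x => (V x : ℂ) * pd d j u x + ((pd d j V x : ℝ) : ℂ) * u x := by
  funext x
  have h := ((hV x).hasFDerivAt.smul (hu x).hasFDerivAt).fderiv
  have h2 : (fun x => (V x : ℂ) * u x) = V • u := by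
    funext y; simp
  simp only [pd, h2]
  rw [h]
  simp

lemma pd_sum_const_mul {ι : Type*} (s : Finset ι) (c : ι → ℂ) {f : ι → Ed d → ℂ}
    (hf : ∀ i, Differentiable ℝ (f i)) (j : Fin d) :
    pd d j (fun x => ∑ i ∈ s, c i * f i x) = fun x => ∑ i ∈ s, c i * pd d j (f i) x := by
  funext x
  have h : HasFDerivAt (fun x => ∑ i ∈ s, c i * f i x)
      (∑ i ∈ s, c i • fderiv ℝ (f i) x) x :=
    HasFDerivAt.fun_sum fun i _ => ((hf i x).hasFDerivAt).const_mul (c i)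
  simp only [pd]
  rw [h.fderiv]
  simp

lemma iterate_pd_sum_const_mul {ι : Type*} (s : Finset ι) (c : ι → ℂ) {f : ι → Ed d → ℂ}
    (hf : ∀ i, ContDiff ℝ (⊤ : ℕ∞) (f i)) (j : Fin d) (n : ℕ) :
    (pd d j)^[n] (fun x => ∑ i ∈ s, c i * f i x) =
      fun x => ∑ i ∈ s, c i * (pd d j)^[n] (f i) x := by
  induction n with
  | zero => rfl
  | succ n ih =>
    rw [Function.iterate_succ_apply', ih,
      pd_sum_const_mul s c fun i => (contDiff_iterate_pd (hf i) j n).differentiable_of_top]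
    simp only [Function.iterate_succ_apply']

/-- Leibniz rule for iterated derivatives in one coordinate direction. -/
lemma iterate_pd_ofReal_mul {V : Ed d → ℝ} {u : Ed d → ℂ} (hV : ContDiff ℝ (⊤ : ℕ∞) V)
    (hu : ContDiff ℝ (⊤ : ℕ∞) u) (j : Fin d) (n : ℕ) :
    (pd d j)^[n] (fun x => (V x : ℂ) * u x) =
      fun x => ∑ k ∈ Finset.range (n + 1),
        (n.choose k : ℂ) * ((((pd d j)^[k] V x : ℝ) : ℂ) * (pd d j)^[n - k] u x) := by
  induction n with
  | zero => simp
  | succ n ih =>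
    have hs : ∀ k, ContDiff ℝ (⊤ : ℕ∞)
        fun x => (((pd d j)^[k] V x : ℝ) : ℂ) * (pd d j)^[n - k] u x := fun k =>
      (Complex.ofRealCLM.contDiff.comp (contDiff_iterate_pd hV j k)).mul
        (contDiff_iterate_pd hu j (n - k))
    rw [Function.iterate_succ_apply', ih,
      pd_sum_const_mul _ _ fun k => (hs k).differentiable_of_top]
    funext x
    rw [Finset.sum_choose_succ_mul
      (fun a b => (((pd d j)^[a] V x : ℝ) : ℂ) * (pd d j)^[b] u x), ← Finset.sum_add_distrib]
    refine Finset.sum_congr rfl fun k hk => ?_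
    rw [pd_ofReal_mul (contDiff_iterate_pd hV j k).differentiable_of_top
      (contDiff_iterate_pd hu j (n - k)).differentiable_of_top]
    have hk' : n + 1 - k = (n - k) + 1 := by
      have := Finset.mem_range.1 hk
      omega
    rw [hk']
    simp only [Function.iterate_succ_apply']
    ring

/-- Iterated partial derivative of order `α j` in each of the directions `e j`. -/
def mdAlong {n : ℕ} (e : Fin n → Fin d) (α : Fin n → ℕ) (f : Ed d → F) : Ed d → F :=
  (List.finRange n).foldr (fun j g => (pd d (e j))^[α j] g) f

lemma mdAlong_succ {n : ℕ} (e : Fin (n + 1) → Fin d) (α : Fin (n + 1) → ℕ) (f : Ed d → F) :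
    mdAlong e α f = (pd d (e 0))^[α 0] (mdAlong (Fin.tail e) (Fin.tail α) f) := by
  simp [mdAlong, List.finRange_succ, List.foldr_map, Fin.tail]

lemma mdAlong_zero (e : Fin 0 → Fin d) (α : Fin 0 → ℕ) (f : Ed d → F) :
    mdAlong e α f = f := by
  simp [mdAlong]

lemma contDiff_mdAlong {f : Ed d → F} (hf : ContDiff ℝ (⊤ : ℕ∞) f) {n : ℕ}
    (e : Fin n → Fin d) (α : Fin n → ℕ) : ContDiff ℝ (⊤ : ℕ∞) (mdAlong e α f) := by
  induction n with
  | zero => rwa [mdAlong_zero]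
  | succ n ih => rw [mdAlong_succ]; exact contDiff_iterate_pd (ih _ _) _ _

lemma contDiff_md {f : Ed d → F} (hf : ContDiff ℝ (⊤ : ℕ∞) f) (α : Fin d → ℕ) :
    ContDiff ℝ (⊤ : ℕ∞) (md α f) := contDiff_mdAlong hf id α

/-- Leibniz rule for derivatives along a finite family of coordinate directions. -/
lemma mdAlong_ofReal_mul {V : Ed d → ℝ} {u : Ed d → ℂ} (hV : ContDiff ℝ (⊤ : ℕ∞) V)
    (hu : ContDiff ℝ (⊤ : ℕ∞) u) {n : ℕ} (e : Fin n → Fin d) (α : Fin n → ℕ) :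
    mdAlong e α (fun x => (V x : ℂ) * u x) =
      fun x => ∑ β ∈ Fintype.piFinset fun j => Finset.range (α j + 1),
        (mchoose α β : ℂ) * (((mdAlong e β V x : ℝ) : ℂ) * mdAlong e (α - β) u x) := by
  induction n with
  | zero => funext x; simp [mdAlong_zero, mchoose]
  | succ n ih =>
    have hs : ∀ β : Fin n → ℕ, ContDiff ℝ (⊤ : ℕ∞) fun x =>
        ((mdAlong (Fin.tail e) β V x : ℝ) : ℂ) * mdAlong (Fin.tail e) (Fin.tail α - β) u x := fun β =>
      (Complex.ofRealCLM.contDiff.comp (contDiff_mdAlong hV _ _)).mul (contDiff_mdAlong hu _ _)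
    rw [mdAlong_succ, ih, iterate_pd_sum_const_mul _ _ hs]
    funext x
    simp only [iterate_pd_ofReal_mul (contDiff_mdAlong hV (Fin.tail e) _)
      (contDiff_mdAlong hu (Fin.tail e) _), Finset.mul_sum]
    rw [Finset.sum_sigma']
    refine Finset.sum_bij' (fun p _ => (Fin.cons p.2 p.1 : Fin (n + 1) → ℕ))
      (fun β _ => ⟨Fin.tail β, β 0⟩) ?_ ?_ ?_ ?_ ?_
    · rintro ⟨β, k⟩ h
      simp only [Finset.mem_sigma, Fintype.mem_piFinset] at h
      rw [Fintype.mem_piFinset, Fin.forall_fin_succ]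
      exact ⟨by simpa using h.2, by simpa [Fin.tail] using h.1⟩
    · intro β h
      rw [Fintype.mem_piFinset, Fin.forall_fin_succ] at h
      simp only [Finset.mem_sigma, Fintype.mem_piFinset]
      exact ⟨by simpa [Fin.tail] using h.2, h.1⟩
    · rintro ⟨β, k⟩ h
      simp
    · intro β h
      simp
    · rintro ⟨β, k⟩ h
      have hsub : Fin.tail (α - (Fin.cons k β : Fin (n + 1) → ℕ)) = Fin.tail α - β := by
        funext i; simp [Fin.tail]
      rw [mdAlong_succ, mdAlong_succ, hsub]
      simp only [mchoose, Fin.prod_univ_succ, Fin.cons_zero, Fin.cons_succ, Fin.tail_cons,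
        Pi.sub_apply]
      push_cast
      simp only [Fin.tail]
      ring

lemma md_ofReal_mul {V : Ed d → ℝ} {u : Ed d → ℂ} (hV : ContDiff ℝ (⊤ : ℕ∞) V)
    (hu : ContDiff ℝ (⊤ : ℕ∞) u) (α : Fin d → ℕ) (x : Ed d) :
    md α (fun x => (V x : ℂ) * u x) x =
      ∑ β ∈ Fintype.piFinset fun j => Finset.range (α j + 1),
        (mchoose α β : ℂ) * (((md β V x : ℝ) : ℂ) * md (α - β) u x) :=
  congrFun (mdAlong_ofReal_mul hV hu id α) x

lemma foldr_iterate_pd_single (j : Fin d) (n : ℕ) (f : Ed d → F) (l : List (Fin d))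
    (hl : l.Nodup) :
    l.foldr (fun i g => (pd d i)^[(Pi.single j n : Fin d → ℕ) i] g) f =
      if j ∈ l then (pd d j)^[n] f else f := by
  induction l with
  | nil => simp
  | cons i l ih =>
    obtain ⟨hi, hl⟩ := List.nodup_cons.1 hl
    rw [List.foldr_cons, ih hl]
    by_cases hij : i = j
    · subst hij
      simp [hi]
    · simp [hij, Ne.symm hij]

lemma md_single (j : Fin d) (n : ℕ) (f : Ed d → F) :
    md (Pi.single j n) f = (pd d j)^[n] f := by
  rw [md, foldr_iterate_pd_single j n f _ (List.nodup_finRange d)]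
  simp

lemma md_zero (f : Ed d → F) : md (0 : Fin d → ℕ) f = f := by
  have h : ∀ l : List (Fin d),
      l.foldr (fun i g => (pd d i)^[(0 : Fin d → ℕ) i] g) f = f := by
    intro l; induction l <;> simp_all
  exact h _

lemma exists_schwartzMap_mdAlong (u : SchwartzMap (Ed d) F) {n : ℕ} (e : Fin n → Fin d)
    (α : Fin n → ℕ) : ∃ w : SchwartzMap (Ed d) F, ⇑w = mdAlong e α ⇑u := by
  have hpd : ∀ (j : Fin d) (k : ℕ) (w : SchwartzMap (Ed d) F),
      ∃ w' : SchwartzMap (Ed d) F, ⇑w' = (pd d j)^[k] ⇑w := by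
    intro j k w
    induction k with
    | zero => exact ⟨w, rfl⟩
    | succ k ih =>
      obtain ⟨w', h⟩ := ih
      refine ⟨LineDeriv.lineDerivOp (EuclideanSpace.single j (1 : ℝ)) w', ?_⟩
      rw [Function.iterate_succ_apply', ← h]
      funext x
      exact SchwartzMap.lineDerivOp_apply_eq_fderiv _ _ _
  induction n with
  | zero => exact ⟨u, (mdAlong_zero e α _).symm⟩
  | succ n ih =>
    obtain ⟨w, h⟩ := ih (Fin.tail e) (Fin.tail α)
    rw [mdAlong_succ, ← h]
    exact hpd _ _ w

lemma exists_schwartzMap_md (u : SchwartzMap (Ed d) F) (α : Fin d → ℕ) :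
    ∃ w : SchwartzMap (Ed d) F, ⇑w = md α ⇑u :=
  exists_schwartzMap_mdAlong u id α

end PartialDerivatives

section GradientBound

lemma le_taylor_of_deriv_le {φ φ' φ'' : ℝ → ℝ} (h1 : ∀ t, HasDerivAt φ (φ' t) t)
    (h2 : ∀ t, HasDerivAt φ' (φ'' t) t) {M : ℝ} (hM : ∀ t, φ'' t ≤ M) {t : ℝ} (ht : 0 ≤ t) :
    φ t ≤ φ 0 + φ' 0 * t + M * t ^ 2 / 2 := by
  have hd : ∀ s, HasDerivAt (fun s => M * s - φ' s) (M - φ'' s) s := fun s =>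
    (((hasDerivAt_id s).const_mul M).sub (h2 s)).congr_deriv (by simp)
  have hmono : Monotone fun s => M * s - φ' s :=
    monotone_of_deriv_nonneg (fun s => (hd s).differentiableAt)
      fun s => by rw [(hd s).deriv]; linarith [hM s]
  have hd2 : ∀ s, HasDerivAt (fun s => φ' 0 * s + M * s ^ 2 / 2 - φ s)
      (φ' 0 + M * s - φ' s) s := fun s => by
    have := ((((hasDerivAt_id s).const_mul (φ' 0)).add
      ((((hasDerivAt_id s).pow 2).const_mul M).div_const 2)).sub (h1 s))
    refine this.congr_deriv ?_
    simp
    ring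
  have hmono2 : MonotoneOn (fun s => φ' 0 * s + M * s ^ 2 / 2 - φ s) (Set.Ici 0) := by
    refine monotoneOn_of_deriv_nonneg (convex_Ici 0)
      (fun s _ => (hd2 s).continuousAt.continuousWithinAt)
      (fun s _ => (hd2 s).differentiableAt.differentiableWithinAt) fun s hs => ?_
    rw [interior_Ici, Set.mem_Ioi] at hs
    have := hmono hs.le
    simp only [mul_zero, zero_sub] at this
    rw [(hd2 s).deriv]
    linarith
  have := hmono2 (Set.mem_Ici.2 le_rfl) (Set.mem_Ici.2 ht) ht
  simp at this
  linarith

/-- Glaeser inequality on the line. -/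
lemma sq_deriv_le_of_nonneg {φ φ' φ'' : ℝ → ℝ} (h1 : ∀ t, HasDerivAt φ (φ' t) t)
    (h2 : ∀ t, HasDerivAt φ' (φ'' t) t) {M : ℝ} (hM : ∀ t, φ'' t ≤ M) (h0 : ∀ t, 0 ≤ φ t) :
    φ' 0 ^ 2 ≤ 2 * M * φ 0 := by
  have key : ∀ t : ℝ, 0 ≤ (M / 2) * (t * t) + φ' 0 * t + φ 0 := by
    intro t
    rcases le_total 0 t with ht | ht
    · have := le_taylor_of_deriv_le h1 h2 hM ht
      linarith [h0 t]
    · have := le_taylor_of_deriv_le (φ := fun s => φ (-s)) (φ' := fun s => -φ' (-s))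
        (φ'' := fun s => φ'' (-s))
        (fun s => ((h1 (-s)).comp s (hasDerivAt_neg s)).congr_deriv (by simp))
        (fun s => ((h2 (-s)).comp s (hasDerivAt_neg s)).neg.congr_deriv (by simp))
        (fun s => hM (-s)) (neg_nonneg.2 ht)
      simp at this
      linarith [h0 t]
  have := discrim_le_zero key
  rw [discrim] at this
  linarith

variable {d : ℕ}

/-- Glaeser inequality for a partial derivative. -/
lemma sq_pd_le_of_nonneg {f : Ed d → ℝ} (hf : ContDiff ℝ (⊤ : ℕ∞) f) (j : Fin d) {M : ℝ}
    (hM : ∀ x, pd d j (pd d j f) x ≤ M) (h0 : ∀ x, 0 ≤ f x) (x : Ed d) :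
    pd d j f x ^ 2 ≤ 2 * M * f x := by
  have hline : ∀ g : Ed d → ℝ, ContDiff ℝ (⊤ : ℕ∞) g → ∀ t : ℝ,
      HasDerivAt (fun t : ℝ => g (x + t • EuclideanSpace.single j (1 : ℝ)))
        (pd d j g (x + t • EuclideanSpace.single j (1 : ℝ))) t := by
    intro g hg t
    have hl : HasDerivAt (fun t : ℝ => x + t • EuclideanSpace.single j (1 : ℝ))
        (EuclideanSpace.single j (1 : ℝ)) t := by
      simpa using ((hasDerivAt_id t).smul_const (EuclideanSpace.single j (1 : ℝ))).const_add x
    exact (hg.differentiable_of_top _).hasFDerivAt.comp_hasDerivAt t hl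
  have := sq_deriv_le_of_nonneg (hline f hf) (hline _ (contDiff_pd hf j))
    (fun t => hM _) (fun t => h0 _)
  simpa using this

lemma norm_fderiv_le_of_abs_pd_le {f : Ed d → ℝ} {x : Ed d} {K : ℝ} (hK : 0 ≤ K)
    (h : ∀ j, |pd d j f x| ≤ K) : ‖fderiv ℝ f x‖ ≤ d * K := by
  refine ContinuousLinearMap.opNorm_le_bound _ (by positivity) fun v => ?_
  have hv : v = ∑ j, v j • EuclideanSpace.single j (1 : ℝ) := by
    ext i
    simp [Finset.sum_apply, Pi.single_apply]
  calc ‖fderiv ℝ f x v‖ = ‖∑ j, v j * pd d j f x‖ := by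
        conv_lhs => rw [hv]
        simp [pd]
    _ ≤ ∑ j : Fin d, K * ‖v‖ := norm_sum_le_of_le _ fun j _ => by
        rw [norm_mul, mul_comm]
        exact mul_le_mul (h j) (PiLp.norm_apply_le v j) (norm_nonneg _) hK
    _ = d * K * ‖v‖ := by simp; ring

/-- A nonnegative function whose gradient is controlled by its square root grows at most
quadratically. -/
lemma exists_le_mul_one_add_norm_sq {f : Ed d → ℝ} (hf : Differentiable ℝ f)
    (h0 : ∀ x, 0 ≤ f x) {M : ℝ} (hM : 0 ≤ M)
    (h : ∀ j x, pd d j f x ^ 2 ≤ M * f x) : ∃ A, 0 ≤ A ∧ ∀ x, f x ≤ A * (1 + ‖x‖) ^ 2 := by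
  have hpos : ∀ x, 0 < f x + 1 := fun x => by linarith [h0 x]
  have hg : ∀ x, HasFDerivAt (fun y => √(f y + 1)) ((1 / (2 * √(f x + 1))) • fderiv ℝ f x) x :=
    fun x => ((hf x).hasFDerivAt.add_const 1).sqrt (hpos x).ne'
  have hb : ∀ x, ‖fderiv ℝ (fun y => √(f y + 1)) x‖ ≤ d * √M := by
    refine fun x => norm_fderiv_le_of_abs_pd_le (Real.sqrt_nonneg M) fun j => ?_
    have h1 : pd d j (fun y => √(f y + 1)) x = pd d j f x / (2 * √(f x + 1)) := by
      simp only [pd]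
      rw [(hg x).fderiv]
      simp
      ring
    have hs := Real.sqrt_pos.2 (hpos x)
    rw [h1, abs_div, abs_of_pos (by positivity : 0 < 2 * √(f x + 1)), div_le_iff₀ (by positivity)]
    have h2 : |pd d j f x| ≤ √M * √(f x + 1) := by
      rw [← Real.sqrt_mul hM]
      refine Real.abs_le_sqrt ((h j x).trans ?_)
      nlinarith
    nlinarith [mul_nonneg (Real.sqrt_nonneg M) hs.le]
  refine ⟨(√(f 0 + 1) + d * √M) ^ 2, by positivity, fun x => ?_⟩
  have hlip := convex_univ.norm_image_sub_le_of_norm_fderiv_le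
    (fun y _ => (hg y).differentiableAt) (fun y _ => hb y) (Set.mem_univ 0) (Set.mem_univ x)
  rw [sub_zero, Real.norm_eq_abs] at hlip
  have h3 : √(f x + 1) ≤ (√(f 0 + 1) + d * √M) * (1 + ‖x‖) := by
    have := (abs_le.1 hlip).2
    have h4 : 0 ≤ √(f 0 + 1) * ‖x‖ := by positivity
    have h5 : 0 ≤ d * √M := by positivity
    nlinarith
  calc f x ≤ √(f x + 1) ^ 2 := by rw [Real.sq_sqrt (hpos x).le]; linarith
    _ ≤ ((√(f 0 + 1) + d * √M) * (1 + ‖x‖)) ^ 2 := by gcongr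
    _ = _ := by ring

end GradientBound

section Combinatorics

variable {d : ℕ}

lemma mem_MI {N : ℕ} {α : Fin d → ℕ} : α ∈ MI d N ↔ mlen α ≤ N := by
  simp only [MI, Finset.mem_filter, Finset.mem_Iic, mlen, and_iff_right_iff_imp]
  exact fun h j => (Finset.single_le_sum (fun i _ => Nat.zero_le (α i)) (Finset.mem_univ j)).trans h

lemma mem_piFinset_range_succ {α β : Fin d → ℕ} :
    (β ∈ Fintype.piFinset fun j => Finset.range (α j + 1)) ↔ β ≤ α := by
  simp [Fintype.mem_piFinset, Pi.le_def]

lemma mlen_mono {α β : Fin d → ℕ} (h : α ≤ β) : mlen α ≤ mlen β :=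
  Finset.sum_le_sum fun j _ => h j

lemma mlen_sub_add {α β : Fin d → ℕ} (h : β ≤ α) : mlen (α - β) + mlen β = mlen α := by
  rw [mlen, mlen, mlen, ← Finset.sum_add_distrib]
  exact Finset.sum_congr rfl fun j _ => Nat.sub_add_cancel (h j)

lemma mchoose_mul_mfact {α β : Fin d → ℕ} (h : β ≤ α) :
    mchoose α β * mfact β * mfact (α - β) = mfact α := by
  simp only [mchoose, mfact, ← Finset.prod_mul_distrib]
  exact Finset.prod_congr rfl fun j _ => Nat.choose_mul_factorial_mul_factorial (h j)

lemma mfact_pos (α : Fin d → ℕ) : 0 < mfact α :=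
  Finset.prod_pos fun _ _ => Nat.factorial_pos _

lemma sum_half_pow_mlen_le (N : ℕ) : ∑ β ∈ MI d N, (1 / 2 : ℝ) ^ mlen β ≤ 2 ^ d := by
  have hsub : MI d N ⊆ Fintype.piFinset fun _ : Fin d => Finset.range (N + 1) := by
    intro β hβ
    simp only [MI, Finset.mem_filter, Finset.mem_Iic] at hβ
    simp only [Fintype.mem_piFinset, Finset.mem_range]
    exact fun j => Nat.lt_succ_of_le (hβ.1 j)
  calc ∑ β ∈ MI d N, (1 / 2 : ℝ) ^ mlen β
      ≤ ∑ β ∈ Fintype.piFinset fun _ : Fin d => Finset.range (N + 1), (1 / 2 : ℝ) ^ mlen β :=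
        Finset.sum_le_sum_of_subset_of_nonneg hsub fun _ _ _ => by positivity
    _ = ∏ _j : Fin d, ∑ k ∈ Finset.range (N + 1), (1 / 2 : ℝ) ^ k := by
        rw [Finset.prod_univ_sum]
        simp only [mlen, Finset.prod_pow_eq_pow_sum]
    _ ≤ ∏ _j : Fin d, (2 : ℝ) :=
        Finset.prod_le_prod (fun _ _ => Finset.sum_nonneg fun _ _ => by positivity)
          fun _ _ => sum_geometric_two_le _
    _ = 2 ^ d := by simp

lemma sum_sum_mul_sub_le {q A : (Fin d → ℕ) → ℝ} (hq : ∀ β, 0 ≤ q β) (hA : ∀ γ, 0 ≤ A γ)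
    (N : ℕ) :
    ∑ α ∈ MI d N, ∑ β ∈ Fintype.piFinset (fun j => Finset.range (α j + 1)), q β * A (α - β) ≤
      (∑ β ∈ MI d N, q β) * ∑ γ ∈ MI d N, A γ := by
  rw [Finset.sum_mul_sum, Finset.sum_sigma', ← Finset.sum_product']
  have hinj : Set.InjOn (fun p : (_ : Fin d → ℕ) × (Fin d → ℕ) => (p.2, p.1 - p.2))
      ((MI d N).sigma fun α => Fintype.piFinset fun j => Finset.range (α j + 1)) := by
    rintro ⟨α, β⟩ h ⟨α', β'⟩ h' heq
    simp only [Finset.coe_sigma, Set.mem_sigma_iff, Finset.mem_coe, mem_piFinset_range_succ]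
      at h h'
    simp only [Prod.mk.injEq] at heq
    obtain ⟨rfl, heq⟩ := heq
    have : α = α' := by rw [← tsub_add_cancel_of_le h.2, heq, tsub_add_cancel_of_le h'.2]
    rw [this]
  rw [← Finset.sum_image (f := fun p : (Fin d → ℕ) × (Fin d → ℕ) => q p.1 * A p.2) hinj]
  refine Finset.sum_le_sum_of_subset_of_nonneg ?_ fun p _ _ => mul_nonneg (hq _) (hA _)
  intro p hp
  obtain ⟨⟨α, β⟩, h, rfl⟩ := Finset.mem_image.1 hp
  simp only [Finset.mem_sigma, mem_piFinset_range_succ, mem_MI] at h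
  simp only [Finset.mem_product, mem_MI]
  exact ⟨(mlen_mono h.2).trans h.1, (mlen_mono tsub_le_self).trans h.1⟩

lemma exists_eq_single_of_mlen_eq_one {β : Fin d → ℕ} (h : mlen β = 1) :
    ∃ j, β = Pi.single j 1 := by
  obtain ⟨j, hj⟩ : ∃ j, β j ≠ 0 := by
    by_contra! h0
    simp [mlen, h0] at h
  refine ⟨j, funext fun i => ?_⟩
  have hsum := Finset.add_sum_erase Finset.univ β (Finset.mem_univ j)
  rw [mlen] at h
  by_cases hij : i = j
  · subst hij
    rw [Pi.single_eq_same]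
    omega
  · have := Finset.single_le_sum (f := β) (s := Finset.univ.erase j) (fun _ _ => Nat.zero_le _)
      (Finset.mem_erase.2 ⟨hij, Finset.mem_univ i⟩)
    rw [Pi.single_eq_of_ne hij]
    omega

lemma mlen_single (j : Fin d) (n : ℕ) : mlen (Pi.single j n) = n := by
  simp [mlen]

lemma mfact_single (j : Fin d) (n : ℕ) : mfact (Pi.single j n) = n.factorial := by
  rw [mfact, Finset.prod_eq_single j] <;> simp +contextual [Pi.single_eq_of_ne]

lemma mlen_eq_zero {β : Fin d → ℕ} : mlen β = 0 ↔ β = 0 := by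
  simp [mlen, funext_iff]

end Combinatorics

section PointwiseBound

variable {d : ℕ} {v : (Fin d → ℕ) → ℝ} {C C₀ ε : ℝ}

lemma mul_mul_le_of_sq_le {w s t m f : ℝ} (hm : 0 ≤ m) (hf : 0 ≤ f)
    (h : w ^ 2 ≤ m * f) : |w| * s * t ≤ (m * s ^ 2 + f * t ^ 2) / 2 := by
  refine le_of_sq_le_sq ?_ (by positivity)
  have h1 : (|w| * s * t) ^ 2 ≤ m * f * (s ^ 2 * t ^ 2) := by
    rw [mul_pow, mul_pow, sq_abs, mul_assoc]
    gcongr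
  nlinarith [sq_nonneg (m * s ^ 2 - f * t ^ 2)]

lemma weighted_derivative_bound (hd : 1 ≤ d) (hC : 0 < C) (hε : 0 < ε) (hεC : ε * C ≤ 1 / 2)
    (hεd : ε ≤ (1 / 2) ^ d) (h0 : 0 ≤ v 0 + C₀)
    (h1 : ∀ j, v (Pi.single j 1) ^ 2 ≤ 4 * C ^ 3 * (v 0 + C₀))
    (h2 : ∀ β, 2 ≤ mlen β → |v β| ≤ C ^ (mlen β + 1) * (mfact β : ℝ))
    {β : Fin d → ℕ} (hβ : β ≠ 0) {s t : ℝ} (hs : 0 ≤ s) (ht : 0 ≤ t) :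
    ε ^ mlen β / mfact β * |v β| * s * t ≤
      (1 / 2) ^ mlen β * ((C + 2 * C ^ 3) * (s ^ 2 + t ^ 2) +
        (1 / 2) ^ d * ((v 0 + C₀) * t ^ 2)) := by
  have hl : mlen β ≠ 0 := fun h => hβ (mlen_eq_zero.1 h)
  have hC3 : 0 < C ^ 3 := by positivity
  rcases (show mlen β = 1 ∨ 2 ≤ mlen β by omega) with h | h
  · obtain ⟨j, rfl⟩ := exists_eq_single_of_mlen_eq_one h
    rw [h, mfact_single]
    have hm := mul_mul_le_of_sq_le (s := s) (t := t) (by positivity : 0 ≤ 4 * C ^ 3) h0 (h1 j)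
    have hε1 : ε ≤ 1 / 2 := hεd.trans (pow_le_of_le_one (by norm_num) (by norm_num) (by omega))
    have hft : 0 ≤ (v 0 + C₀) * t ^ 2 := by positivity
    calc ε ^ 1 / ((Nat.factorial 1 : ℕ) : ℝ) * |v (Pi.single j 1)| * s * t
        = ε * (|v (Pi.single j 1)| * s * t) := by simp; ring
      _ ≤ ε * ((4 * C ^ 3 * s ^ 2 + (v 0 + C₀) * t ^ 2) / 2) := by gcongr
      _ = ε * (2 * C ^ 3 * s ^ 2) + 1 / 2 * (ε * ((v 0 + C₀) * t ^ 2)) := by ring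
      _ ≤ 1 / 2 * (2 * C ^ 3 * s ^ 2) + 1 / 2 * ((1 / 2) ^ d * ((v 0 + C₀) * t ^ 2)) := by
          gcongr
      _ ≤ _ := by
          have h3 : 0 ≤ C * (s ^ 2 + t ^ 2) := by positivity
          have h4 : 0 ≤ C ^ 3 * t ^ 2 := by positivity
          linarith
  · have hf : (0 : ℝ) < mfact β := by exact_mod_cast mfact_pos β
    calc ε ^ mlen β / mfact β * |v β| * s * t
        ≤ ε ^ mlen β / mfact β * (C ^ (mlen β + 1) * (mfact β : ℝ)) * s * t := by
          gcongr
          exact h2 β h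
      _ = (ε * C) ^ mlen β * (C * (s * t)) := by
          rw [mul_pow]
          field_simp
          ring
      _ ≤ (1 / 2) ^ mlen β * (C * (s * t)) := by gcongr
      _ ≤ _ := by
          gcongr
          have h3 : 0 ≤ (1 / 2) ^ d * ((v 0 + C₀) * t ^ 2) := by positivity
          have h4 : 0 ≤ 2 * C ^ 3 * (s ^ 2 + t ^ 2) := by positivity
          have h5 : C * (s * t) ≤ C * (s ^ 2 + t ^ 2) := by
            gcongr
            nlinarith [sq_nonneg (s - t), sq_nonneg s, sq_nonneg t]
          linarith

/-- Pointwise lower bound for the energy density, in terms of the values `v β` of the derivatives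
of the potential and `b α` of those of the function at one point. -/
lemma energy_density_lower_bound (hd : 1 ≤ d) (hC : 0 < C) (hε : 0 < ε) (hεC : ε * C ≤ 1 / 2)
    (hεd : ε ≤ (1 / 2) ^ d) (h0 : 0 ≤ v 0 + C₀)
    (h1 : ∀ j, v (Pi.single j 1) ^ 2 ≤ 4 * C ^ 3 * (v 0 + C₀))
    (h2 : ∀ β, 2 ≤ mlen β → |v β| ≤ C ^ (mlen β + 1) * (mfact β : ℝ))
    (b : (Fin d → ℕ) → ℂ) (N : ℕ) :
    -(C₀ + 2 ^ d * (2 * (C + 2 * C ^ 3))) *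
        ∑ α ∈ MI d N, ε ^ (2 * mlen α) / (mfact α : ℝ) ^ 2 * ‖b α‖ ^ 2 ≤
      ∑ α ∈ MI d N, ε ^ (2 * mlen α) / (mfact α : ℝ) ^ 2 *
        ((∑ β ∈ Fintype.piFinset fun j => Finset.range (α j + 1),
          (mchoose α β : ℂ) * ((v β : ℂ) * b (α - β))) * (starRingEnd ℂ) (b α)).re := by
  set K := C + 2 * C ^ 3
  have hK0 : 0 ≤ K := by positivity
  set a : (Fin d → ℕ) → ℝ := fun α => ε ^ mlen α / mfact α * ‖b α‖ with ha
  have ha0 : ∀ α, 0 ≤ a α := fun α => by positivity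
  have hsq : ∀ α, ε ^ (2 * mlen α) / (mfact α : ℝ) ^ 2 * ‖b α‖ ^ 2 = a α ^ 2 := fun α => by
    simp only [ha]
    rw [mul_pow, div_pow, ← pow_mul, mul_comm 2]
  simp only [hsq]
  set f := v 0 + C₀ with hf
  have hterm : ∀ α β : Fin d → ℕ, β ≤ α →
      (if β = 0 then v 0 * a α ^ 2 else 0) -
        ((1 / 2) ^ mlen β * (K * a (α - β) ^ 2) +
          (1 / 2) ^ mlen β * (K * a α ^ 2 + (1 / 2) ^ d * (f * a α ^ 2))) ≤
      ε ^ (2 * mlen α) / (mfact α : ℝ) ^ 2 *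
        ((mchoose α β : ℂ) * ((v β : ℂ) * b (α - β)) * (starRingEnd ℂ) (b α)).re := by
    intro α β hβ
    by_cases hz : β = 0
    · subst hz
      have hre : ((mchoose α 0 : ℂ) * ((v 0 : ℂ) * b (α - 0)) * (starRingEnd ℂ) (b α)).re =
          v 0 * ‖b α‖ ^ 2 := by
        rw [tsub_zero]
        have : (mchoose α 0 : ℂ) * ((v 0 : ℂ) * b α) * (starRingEnd ℂ) (b α) =
            ((v 0 * ‖b α‖ ^ 2 : ℝ) : ℂ) := by
          rw [mul_assoc, mul_assoc, Complex.mul_conj, Complex.normSq_eq_norm_sq]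
          simp [mchoose]
        rw [this, Complex.ofReal_re]
      rw [hre, if_pos rfl, mul_left_comm _ (v 0), hsq]
      have : 0 ≤ (1 / 2 : ℝ) ^ mlen (0 : Fin d → ℕ) * (K * a (α - 0) ^ 2) +
          (1 / 2) ^ mlen (0 : Fin d → ℕ) * (K * a α ^ 2 + (1 / 2) ^ d * (f * a α ^ 2)) := by
        positivity
      linarith
    · rw [if_neg hz]
      have hb := weighted_derivative_bound hd hC hε hεC hεd h0 h1 h2 hz (ha0 (α - β)) (ha0 α)
      have hre := (abs_le.1 (Complex.abs_re_le_norm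
        ((mchoose α β : ℂ) * ((v β : ℂ) * b (α - β)) * (starRingEnd ℂ) (b α)))).1
      have hnorm : ε ^ (2 * mlen α) / (mfact α : ℝ) ^ 2 *
          ‖(mchoose α β : ℂ) * ((v β : ℂ) * b (α - β)) * (starRingEnd ℂ) (b α)‖ =
          ε ^ mlen β / mfact β * |v β| * a (α - β) * a α := by
        have hf1 : (mfact β : ℝ) ≠ 0 := by exact_mod_cast (mfact_pos β).ne'
        have hf2 : (mfact (α - β) : ℝ) ≠ 0 := by exact_mod_cast (mfact_pos (α - β)).ne'
        have hf3 : (mfact α : ℝ) ≠ 0 := by exact_mod_cast (mfact_pos α).ne'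
        have hch : (mchoose α β : ℝ) = mfact α / (mfact β * mfact (α - β)) := by
          rw [eq_div_iff (by positivity), ← mul_assoc]
          exact_mod_cast mchoose_mul_mfact hβ
        have hpow : ε ^ (2 * mlen α) = ε ^ mlen (α - β) * ε ^ mlen β * ε ^ mlen α := by
          rw [← pow_add, mlen_sub_add hβ, ← pow_add, two_mul]
        simp only [norm_mul, Complex.norm_natCast, Complex.norm_real, Real.norm_eq_abs,
          RCLike.norm_conj, ha]
        rw [hch, hpow]
        field_simp
      have hcoef : 0 ≤ ε ^ (2 * mlen α) / (mfact α : ℝ) ^ 2 := by positivity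
      have := mul_le_mul_of_nonneg_left hre hcoef
      rw [mul_neg, hnorm] at this
      refine le_trans ?_ this
      rw [zero_sub, neg_le_neg_iff]
      refine hb.trans (le_of_eq ?_)
      ring
  have hS1 := sum_sum_mul_sub_le (d := d) (q := fun β => (1 / 2 : ℝ) ^ mlen β)
    (A := fun γ => K * a γ ^ 2) (fun _ => by positivity) (fun _ => by positivity) N
  have hS0 := sum_half_pow_mlen_le (d := d) N
  have hS2 : ∀ α ∈ MI d N, ∑ β ∈ Fintype.piFinset (fun j => Finset.range (α j + 1)),
      (1 / 2 : ℝ) ^ mlen β * (K * a α ^ 2 + (1 / 2) ^ d * (f * a α ^ 2)) ≤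
      2 ^ d * K * a α ^ 2 + f * a α ^ 2 := by
    intro α hα
    rw [← Finset.sum_mul]
    have hle : ∑ β ∈ Fintype.piFinset (fun j => Finset.range (α j + 1)), (1 / 2 : ℝ) ^ mlen β ≤
        2 ^ d := by
      refine le_trans (Finset.sum_le_sum_of_subset_of_nonneg (fun β hβ => ?_)
        fun _ _ _ => by positivity) hS0
      exact mem_MI.2 ((mlen_mono (mem_piFinset_range_succ.1 hβ)).trans (mem_MI.1 hα))
    calc _ ≤ (2 : ℝ) ^ d * (K * a α ^ 2 + (1 / 2) ^ d * (f * a α ^ 2)) := by gcongr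
      _ = 2 ^ d * K * a α ^ 2 + f * a α ^ 2 := by
        have h12 : (2 : ℝ) ^ d * (1 / 2) ^ d = 1 := by rw [← mul_pow]; norm_num
        linear_combination f * a α ^ 2 * h12
  have hmain : ∑ α ∈ MI d N, ∑ β ∈ Fintype.piFinset (fun j => Finset.range (α j + 1)),
      ((if β = 0 then v 0 * a α ^ 2 else 0) -
        ((1 / 2) ^ mlen β * (K * a (α - β) ^ 2) +
          (1 / 2) ^ mlen β * (K * a α ^ 2 + (1 / 2) ^ d * (f * a α ^ 2)))) ≤
      ∑ α ∈ MI d N, ε ^ (2 * mlen α) / (mfact α : ℝ) ^ 2 *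
        ((∑ β ∈ Fintype.piFinset fun j => Finset.range (α j + 1),
          (mchoose α β : ℂ) * ((v β : ℂ) * b (α - β))) * (starRingEnd ℂ) (b α)).re := by
    refine Finset.sum_le_sum fun α _ => ?_
    rw [Finset.sum_mul, Complex.re_sum, Finset.mul_sum]
    exact Finset.sum_le_sum fun β hβ => hterm α β (mem_piFinset_range_succ.1 hβ)
  refine le_trans ?_ hmain
  simp only [Finset.sum_sub_distrib, Finset.sum_add_distrib]
  have hdiag : ∀ α : Fin d → ℕ, ∑ β ∈ Fintype.piFinset (fun j => Finset.range (α j + 1)),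
      (if β = 0 then v 0 * a α ^ 2 else 0) = v 0 * a α ^ 2 := fun α => by
    rw [Finset.sum_ite_eq', if_pos (mem_piFinset_range_succ.2 (zero_le (a := α)))]
  simp only [hdiag]
  have hS2' := Finset.sum_le_sum hS2
  have hS1' := hS1.trans (mul_le_mul_of_nonneg_right hS0
    (Finset.sum_nonneg fun γ _ => by positivity))
  rw [← Finset.mul_sum] at hS1'
  rw [Finset.sum_add_distrib, ← Finset.mul_sum, ← Finset.mul_sum] at hS2'
  rw [← Finset.mul_sum]
  have hfv : f * ∑ α ∈ MI d N, a α ^ 2 =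
      v 0 * ∑ α ∈ MI d N, a α ^ 2 + C₀ * ∑ α ∈ MI d N, a α ^ 2 := by
    rw [hf]; ring
  linarith

end PointwiseBound

section Integrability

variable {d : ℕ}

lemma integrable_mul_schwartzMap_mul_conj {g : Ed d → ℝ} (hg : Continuous g) {A : ℝ}
    (hA : ∀ x, |g x| ≤ A * (1 + ‖x‖) ^ 2) (w₁ w₂ : SchwartzMap (Ed d) ℂ) :
    Integrable fun x => (g x : ℂ) * w₁ x * (starRingEnd ℂ) (w₂ x) := by
  obtain ⟨B, hB, hw⟩ := w₂.decay 0 0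
  simp only [pow_zero, one_mul, norm_iteratedFDeriv_zero] at hw
  have hA0 : 0 ≤ A := by simpa using (abs_nonneg _).trans (hA 0)
  have hint : Integrable fun x : Ed d =>
      2 * A * B * (‖x‖ ^ 0 * ‖w₁ x‖) + 2 * A * B * (‖x‖ ^ 2 * ‖w₁ x‖) :=
    ((w₁.integrable_pow_mul volume 0).const_mul _).add
      ((w₁.integrable_pow_mul volume 2).const_mul _)
  refine hint.mono' ?_ (Filter.Eventually.of_forall fun x => ?_)
  · have h1 := w₁.continuous
    have h2 := w₂.continuous
    exact Continuous.aestronglyMeasurable (by fun_prop)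
  · rw [norm_mul, norm_mul, Complex.norm_real, Real.norm_eq_abs, RCLike.norm_conj]
    calc |g x| * ‖w₁ x‖ * ‖w₂ x‖ ≤ A * (1 + ‖x‖) ^ 2 * ‖w₁ x‖ * B := by
          gcongr
          · exact hA x
          · exact hw x
      _ ≤ A * (2 + 2 * ‖x‖ ^ 2) * ‖w₁ x‖ * B := by
          gcongr
          nlinarith [sq_nonneg (1 - ‖x‖)]
      _ = _ := by ring

lemma integrable_norm_sq_schwartzMap (w : SchwartzMap (Ed d) ℂ) :
    Integrable fun x => ‖w x‖ ^ 2 := by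
  have h := (integrable_mul_schwartzMap_mul_conj (g := fun _ => 1) continuous_const (A := 1)
    (fun x => by rw [abs_one, one_mul]; nlinarith [norm_nonneg x]) w w).norm
  refine h.congr (Filter.Eventually.of_forall fun x => ?_)
  simp [sq]

lemma exists_abs_md_le {V : Ed d → ℝ} {C C₀ : ℝ} (hC : 0 < C)
    (hV : ContDiff ℝ (⊤ : ℕ∞) V) (hVlower : ∀ x, -C₀ ≤ V x)
    (hgrad : ∀ j x, pd d j V x ^ 2 ≤ 4 * C ^ 3 * (V x + C₀))
    (hVbd : ∀ β : Fin d → ℕ, 2 ≤ mlen β → ∀ x,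
      |md β V x| ≤ C ^ (mlen β + 1) * (mfact β : ℝ)) (β : Fin d → ℕ) :
    ∃ A, ∀ x, |md β V x| ≤ A * (1 + ‖x‖) ^ 2 := by
  have hone : ∀ x : Ed d, 1 ≤ (1 + ‖x‖) ^ 2 := fun x => by nlinarith [norm_nonneg x]
  have hpd : ∀ j x, pd d j (fun x => V x + C₀) x = pd d j V x := fun j x => by
    simp [pd]
  obtain ⟨A, hA0, hA⟩ := exists_le_mul_one_add_norm_sq (f := fun x => V x + C₀)
    (hV.differentiable_of_top.add_const C₀) (fun x => by linarith [hVlower x])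
    (by positivity : 0 ≤ 4 * C ^ 3) (fun j x => by rw [hpd]; exact hgrad j x)
  rcases (show mlen β = 0 ∨ mlen β = 1 ∨ 2 ≤ mlen β by omega) with h | h | h
  · rw [mlen_eq_zero.1 h, md_zero]
    refine ⟨A + |C₀|, fun x => abs_le.2 ⟨?_, ?_⟩⟩
    · nlinarith [hVlower x, le_abs_self C₀, abs_nonneg C₀, hone x]
    · nlinarith [hA x, neg_abs_le C₀, abs_nonneg C₀, hone x]
  · obtain ⟨j, rfl⟩ := exists_eq_single_of_mlen_eq_one h
    rw [md_single]
    refine ⟨1 + 4 * C ^ 3 * A, fun x => ?_⟩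
    have h1 : pd d j V x ^ 2 ≤ 4 * C ^ 3 * (A * (1 + ‖x‖) ^ 2) :=
      (hgrad j x).trans (mul_le_mul_of_nonneg_left (hA x) (by positivity))
    have h2 : |pd d j V x| ≤ 1 + pd d j V x ^ 2 := by
      rw [← sq_abs]
      nlinarith [sq_nonneg (|pd d j V x| - 1), abs_nonneg (pd d j V x)]
    rw [Function.iterate_one]
    nlinarith [hone x]
  · refine ⟨C ^ (mlen β + 1) * mfact β, fun x => (hVbd β h x).trans ?_⟩
    exact le_mul_of_one_le_right (by positivity) (hone x)

end Integrability

/-- Lower bound for the analytic-scale energy form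
`ℰ^ε_N[Vu, u] = Σ_{|α|≤N} (ε^{2|α|}/α!²)⟨∂^α(Vu), ∂^α u⟩` (Lemma 6.2, first part,
for the multiplication operator). The constants `ε, C'` are independent of `N`. -/
theorem statement14 (d : ℕ) (hd : 1 ≤ d) (C₀ C : ℝ) (hC₀ : 0 < C₀) (hC : 0 < C)
    (V : Ed d → ℝ) (hVsmooth : ContDiff ℝ (⊤ : ℕ∞) V)
    (hVlower : ∀ x, -C₀ ≤ V x)
    (hVbd : ∀ β : Fin d → ℕ, 2 ≤ mlen β → ∀ x,
      |md β V x| ≤ C ^ (mlen β + 1) * (mfact β : ℝ)) :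
    ∃ ε > (0 : ℝ), ∃ C' > (0 : ℝ), ∀ N : ℕ, ∀ u : SchwartzMap (Ed d) ℂ,
      (∑ α ∈ MI d N, (((ε ^ (2 * mlen α) / (mfact α : ℝ) ^ 2 : ℝ)) : ℂ) *
          ip (md α (fun x => (V x : ℂ) * u x)) (md α ⇑u)).re
        ≥ -C' * ∑ α ∈ MI d N, (ε ^ (2 * mlen α) / (mfact α : ℝ) ^ 2) * l2sq (md α ⇑u) := by
  have hd1 : ∀ x, 0 ≤ V x + C₀ := fun x => by linarith [hVlower x]
  have hgrad : ∀ j x, pd d j V x ^ 2 ≤ 4 * C ^ 3 * (V x + C₀) := by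
    intro j x
    have hpd : pd d j (fun x => V x + C₀) = pd d j V := by
      funext x
      simp [pd]
    have h := sq_pd_le_of_nonneg (f := fun x => V x + C₀) (hVsmooth.add contDiff_const) j
      (M := 2 * C ^ 3) (fun y => ?_) hd1 x
    · rw [hpd] at h
      linarith
    · have h2 := (abs_le.1 (hVbd (Pi.single j 2) (mlen_single j 2).ge y)).2
      rw [md_single, mlen_single, mfact_single] at h2
      rw [hpd]
      calc pd d j (pd d j V) y ≤ C ^ (2 + 1) * ((Nat.factorial 2 : ℕ) : ℝ) := h2
        _ = 2 * C ^ 3 := by simp; ring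
  have hε : 0 < min (1 / (2 * C)) ((1 / 2 : ℝ) ^ d) := by positivity
  refine ⟨min (1 / (2 * C)) ((1 / 2) ^ d), hε, C₀ + 2 ^ d * (2 * (C + 2 * C ^ 3)),
    by positivity, fun N u => ?_⟩
  have hεd : min (1 / (2 * C)) ((1 / 2 : ℝ) ^ d) ≤ (1 / 2) ^ d := min_le_right _ _
  have hεC : min (1 / (2 * C)) ((1 / 2 : ℝ) ^ d) * C ≤ 1 / 2 := by
    calc _ ≤ 1 / (2 * C) * C := by gcongr; exact min_le_left _ _
      _ = 1 / 2 := by field_simp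
  generalize min (1 / (2 * C)) ((1 / 2 : ℝ) ^ d) = ε at hε hεd hεC
  have hsq : ∀ α : Fin d → ℕ, Integrable fun x => ‖md α ⇑u x‖ ^ 2 := fun α => by
    obtain ⟨w, hw⟩ := exists_schwartzMap_md u α
    rw [← hw]
    exact integrable_norm_sq_schwartzMap w
  have hip : ∀ α : Fin d → ℕ, Integrable fun x =>
      md α (fun x => (V x : ℂ) * u x) x * (starRingEnd ℂ) (md α ⇑u x) := fun α => by
    simp only [md_ofReal_mul hVsmooth (u.smooth _), Finset.sum_mul]
    refine integrable_finsetSum _ fun β _ => ?_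
    obtain ⟨A, hA⟩ := exists_abs_md_le hC hVsmooth hVlower hgrad hVbd β
    obtain ⟨w₁, hw₁⟩ := exists_schwartzMap_md u (α - β)
    obtain ⟨w₂, hw₂⟩ := exists_schwartzMap_md u α
    rw [← hw₁, ← hw₂]
    refine ((integrable_mul_schwartzMap_mul_conj (contDiff_md hVsmooth β).continuous hA
      w₁ w₂).const_mul (mchoose α β : ℂ)).congr (Filter.Eventually.of_forall fun x => ?_)
    simp only [mul_assoc]
  have hre : ∀ α : Fin d → ℕ, Integrable fun x =>
      (md α (fun x => (V x : ℂ) * u x) x * (starRingEnd ℂ) (md α ⇑u x)).re := fun α => (hip α).re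
  have hl : (∑ α ∈ MI d N, (((ε ^ (2 * mlen α) / (mfact α : ℝ) ^ 2 : ℝ)) : ℂ) *
        ip (md α (fun x => (V x : ℂ) * u x)) (md α ⇑u)).re =
      ∫ x, ∑ α ∈ MI d N, ε ^ (2 * mlen α) / (mfact α : ℝ) ^ 2 *
        (md α (fun x => (V x : ℂ) * u x) x * (starRingEnd ℂ) (md α ⇑u x)).re := by
    rw [integral_finsetSum _ fun α _ => (hre α).const_mul _, Complex.re_sum]
    refine Finset.sum_congr rfl fun α _ => ?_
    rw [Complex.re_ofReal_mul, integral_const_mul, ip]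
    congr 1
    exact (integral_re (hip α)).symm
  have hr : ∑ α ∈ MI d N, (ε ^ (2 * mlen α) / (mfact α : ℝ) ^ 2) * l2sq (md α ⇑u) =
      ∫ x, ∑ α ∈ MI d N, ε ^ (2 * mlen α) / (mfact α : ℝ) ^ 2 * ‖md α ⇑u x‖ ^ 2 := by
    rw [integral_finsetSum _ fun α _ => (hsq α).const_mul _]
    simp only [integral_const_mul, l2sq]
  rw [hl, hr, ge_iff_le, ← integral_const_mul]
  refine integral_mono ((integrable_finsetSum _ fun α _ => (hsq α).const_mul _).const_mul _)
    (integrable_finsetSum _ fun α _ => (hre α).const_mul _) fun x => ?_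
  simp only [md_ofReal_mul hVsmooth (u.smooth _)]
  exact energy_density_lower_bound (v := fun β => md β V x) hd hC hε hεC hεd
    (by simpa only [md_zero] using hd1 x)
    (fun j => by simpa only [md_single, md_zero, Function.iterate_one] using hgrad j x)
    (fun β hβ => hVbd β hβ x) (fun α => md α ⇑u x) N
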